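/- For every real λ > 0 there exists a real t > 0 such that ∫_0^∞ e^{−λ·r²} · sinh(r) · sin(t·r) dr < 0. (Consequently the spherical transform of the Gaussian kernel on three-dimensional hyperbolic space changes sign for every value of λ, which is the analytic content of the statement that the Gaussian kernel e^{−λ d(x,y)²} is not positive-definite on the three-dimensional hyperbolic space for any λ > 0.) -/

import Mathlib

open MeasureTheory

lemma cexp_ofReal_add_ofReal_mul_I_im (a b : ℝ) :
    (Complex.exp ((a : ℂ) + (b : ℂ) * Complex.I)).im = Real.exp a * Real.sin b := by
  simp [Complex.exp_im]

/-- The integrand of the Gaussian against `e^r sin (t r)` is the imaginary part of a complex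
Gaussian. -/
lemma cexp_quadratic_im (lam t r : ℝ) :
    (Complex.exp (-(lam : ℂ) * r ^ 2 + (1 + t * Complex.I) * r + 0)).im =
      Real.exp (-lam * r ^ 2) * Real.exp r * Real.sin (t * r) := by
  have h : -(lam : ℂ) * r ^ 2 + (1 + t * Complex.I) * r + 0 =
      ((-lam * r ^ 2 + r : ℝ) : ℂ) + ((t * r : ℝ) : ℂ) * Complex.I := by
    push_cast
    ring
  rw [h, cexp_ofReal_add_ofReal_mul_I_im, Real.exp_add]

lemma integrable_exp_neg_mul_sq_mul_exp_mul_sin {lam : ℝ} (hlam : 0 < lam) (t : ℝ) :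
    Integrable fun r : ℝ => Real.exp (-lam * r ^ 2) * Real.exp r * Real.sin (t * r) := by
  have h := integrable_cexp_quadratic (b := (lam : ℂ)) (by simpa using hlam)
    (1 + t * Complex.I) 0
  simpa only [RCLike.im_eq_complex_im, cexp_quadratic_im] using h.im

lemma integral_exp_neg_mul_sq_mul_exp_mul_sin {lam : ℝ} (hlam : 0 < lam) (t : ℝ) :
    ∫ r : ℝ, Real.exp (-lam * r ^ 2) * Real.exp r * Real.sin (t * r) =
      √(Real.pi / lam) * (Real.exp ((1 - t ^ 2) / (4 * lam)) * Real.sin (t / (2 * lam))) := by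
  have hne : (lam : ℂ) ≠ 0 := by exact_mod_cast hlam.ne'
  have hint := integrable_cexp_quadratic (b := (lam : ℂ)) (by simpa using hlam)
    (1 + t * Complex.I) 0
  have hval := integral_cexp_quadratic (b := -(lam : ℂ)) (by simpa using hlam)
    (1 + t * Complex.I) 0
  have him := integral_im hint
  simp only [RCLike.im_eq_complex_im, cexp_quadratic_im] at him
  have hsqrt : ((Real.pi : ℂ) / - -(lam : ℂ)) ^ (1 / 2 : ℂ) = (√(Real.pi / lam) : ℝ) := by
    rw [neg_neg, Real.sqrt_eq_rpow, Complex.ofReal_cpow (by positivity)]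
    push_cast
    rfl
  have hexp : (0 : ℂ) - (1 + t * Complex.I) ^ 2 / (4 * -(lam : ℂ)) =
      (((1 - t ^ 2) / (4 * lam) : ℝ) : ℂ) + ((t / (2 * lam) : ℝ) : ℂ) * Complex.I := by
    push_cast
    field_simp
    ring_nf
    rw [Complex.I_sq]
    ring
  rw [him, hval, hsqrt, hexp, Complex.im_ofReal_mul,
    cexp_ofReal_add_ofReal_mul_I_im]

/-- The sine transform of the Gaussian weighted by `sinh`. -/
lemma integral_Ioi_exp_neg_mul_sq_mul_sinh_mul_sin {lam : ℝ} (hlam : 0 < lam) (t : ℝ) :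
    ∫ r in Set.Ioi (0 : ℝ), Real.exp (-lam * r ^ 2) * Real.sinh r * Real.sin (t * r) =
      √(Real.pi / lam) * (Real.exp ((1 - t ^ 2) / (4 * lam)) * Real.sin (t / (2 * lam))) / 2 := by
  set g : ℝ → ℝ := fun r => Real.exp (-lam * r ^ 2) * Real.sinh r * Real.sin (t * r) with hg
  set f : ℝ → ℝ := fun r => Real.exp (-lam * r ^ 2) * Real.exp r * Real.sin (t * r) with hf
  have hint : Integrable f := integrable_exp_neg_mul_sq_mul_exp_mul_sin hlam t
  have habs (r : ℝ) : g |r| = (f r + f (-r)) / 2 := by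
    have hgf (s : ℝ) : g s = (f s + f (-s)) / 2 := by
      simp only [hg, hf, Real.sinh_eq, mul_neg, Real.sin_neg, neg_sq]
      ring
    rcases abs_choice r with h | h <;> rw [h, hgf]
    rw [neg_neg, add_comm]
  have h := integral_comp_abs (f := g)
  simp only [habs] at h
  rw [integral_div, integral_add hint hint.comp_neg, integral_neg_eq_self f volume,
    integral_exp_neg_mul_sq_mul_exp_mul_sin hlam t] at h
  linarith

/-- For every `λ > 0` there is `t > 0` at which the spherical transform of the Gaussian kernel
on three-dimensional hyperbolic space is negative; hence the Gaussian kernel `e^{−λ d(x,y)²}`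
is not positive-definite on the three-dimensional hyperbolic space for any `λ > 0`. -/
theorem gaussian_spherical_transform_H3_neg (lam : ℝ) (hlam : 0 < lam) :
    ∃ t : ℝ, 0 < t ∧
      (∫ r in Set.Ioi (0 : ℝ), Real.exp (-lam * r ^ 2) * Real.sinh r * Real.sin (t * r)) < 0 := by
  refine ⟨3 * Real.pi * lam, by positivity, ?_⟩
  have hsin : Real.sin (3 * Real.pi * lam / (2 * lam)) = -1 := by
    rw [show 3 * Real.pi * lam / (2 * lam) = Real.pi / 2 + Real.pi by field_simp; ring,
      Real.sin_add_pi, Real.sin_pi_div_two]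
  rw [integral_Ioi_exp_neg_mul_sq_mul_sinh_mul_sin hlam, hsin]
  have : 0 < √(Real.pi / lam) * Real.exp ((1 - (3 * Real.pi * lam) ^ 2) / (4 * lam)) := by
    positivity
  linarith
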